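/- arXiv:2012.02335 — 3 statements merged into one kernel-verified Lean document; each statement's English description precedes it below -/
import Mathlib

section
/- There exists a universal constant c > 0 such that for every positive integer n and every Boolean function f : {-1,1}^n → {-1,1} with k(f) > 1, δ(f) ≥ c · r(f) / (k''(f) · log k(f)). -/
open scoped BigOperators
open scoped Classical

noncomputable section

namespace BoolFunc

/-- Real value of a hypercube coordinate: `true ↦ -1`, `false ↦ 1`. -/
def signv (b : Bool) : ℝ := if b then -1 else 1

/-- Fourier coefficient `f̂(S)` of `f : {-1,1}ⁿ → ℝ`. -/
def fourierCoeff {n : ℕ} (f : (Fin n → Bool) → ℝ) (S : Finset (Fin n)) : ℝ :=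
  (∑ x : Fin n → Bool, f x * ∏ i ∈ S, signv (x i)) / 2 ^ n

/-- Fourier support of `f`. -/
def fourierSupport {n : ℕ} (f : (Fin n → Bool) → ℝ) : Finset (Finset (Fin n)) :=
  Finset.univ.filter (fun S => fourierCoeff f S ≠ 0)

/-- Fourier sparsity `k(f)`. -/
def sparsity {n : ℕ} (f : (Fin n → Bool) → ℝ) : ℕ := (fourierSupport f).card

/-- Indicator vector in `F₂ⁿ` of a subset of `[n]`. -/
def indicatorVec {n : ℕ} (S : Finset (Fin n)) : Fin n → ZMod 2 :=
  fun i => if i ∈ S then 1 else 0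

/-- Fourier rank `r(f)`: the `F₂`-dimension of the span of the Fourier support. -/
def fourierRank {n : ℕ} (f : (Fin n → Bool) → ℝ) : ℕ :=
  Module.finrank (ZMod 2)
    ↥(Submodule.span (ZMod 2)
      (indicatorVec '' (fourierSupport f : Set (Finset (Fin n)))))

/-- Weight `δ(f) = Pr[f(x) = -1]`. -/
def weight {n : ℕ} (f : (Fin n → Bool) → ℝ) : ℝ :=
  ((Finset.univ.filter (fun x : Fin n → Bool => f x = -1)).card : ℝ) / 2 ^ n

/-- Fourier max-supp-entropy `k'(f) = max_{S ∈ supp(f)} 1/|f̂(S)|`. -/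
def maxSuppEntropy {n : ℕ} (f : (Fin n → Bool) → ℝ) : ℝ :=
  sSup ((fun S => 1 / |fourierCoeff f S|) '' (fourierSupport f : Set (Finset (Fin n))))

/-- Dimension of the span of `{S : |f̂(S)| ≥ 1/t}`. -/
def levelDim {n : ℕ} (f : (Fin n → Bool) → ℝ) (t : ℝ) : ℕ :=
  Module.finrank (ZMod 2)
    ↥(Submodule.span (ZMod 2)
      (indicatorVec '' {S : Finset (Fin n) | 1 / t ≤ |fourierCoeff f S|}))

/-- Fourier max-rank-entropy `k''(f)`. -/
def maxRankEntropy {n : ℕ} (f : (Fin n → Bool) → ℝ) : ℝ :=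
  sInf {t : ℝ | 0 < t ∧ levelDim f t = fourierRank f}

/-- `f` is Boolean-valued (takes values in `{-1,1}`). -/
def IsBooleanFunc {n : ℕ} (f : (Fin n → Bool) → ℝ) : Prop := ∀ x, f x = 1 ∨ f x = -1


lemma card_Icc_zmod_two {ι : Type*} [DecidableEq ι] (U W : Finset ι) :
    ((Finset.Icc U W).card : ZMod 2) = if U = W then 1 else 0 := by
  split_ifs with h
  · subst h; simp
  · by_cases hs : U ⊆ W
    · rw [Finset.card_Icc_finset hs]
      have hlt := Finset.card_lt_card (Finset.ssubset_iff_subset_ne.2 ⟨hs, h⟩)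
      obtain ⟨j, hj⟩ := Nat.exists_eq_succ_of_ne_zero (Nat.sub_ne_zero_of_lt hlt)
      rw [hj, pow_succ]
      push_cast
      rw [show (2 : ZMod 2) = 0 from rfl, mul_zero]
    · rw [Finset.Icc_eq_empty hs]; simp

lemma sum_eq_sum_card_lt {α : Type*} (s : Finset α) (h : α → ℕ) {M : ℕ} (hM : ∀ a ∈ s, h a ≤ M) :
    ∑ a ∈ s, h a = ∑ m ∈ Finset.range M, (s.filter fun a => m < h a).card := by
  simp_rw [Finset.card_filter]
  rw [Finset.sum_comm]
  refine Finset.sum_congr rfl fun a ha => ?_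
  rw [← Finset.card_filter]
  have : (Finset.range M).filter (fun m => m < h a) = Finset.range (h a) := by
    ext m; simp only [Finset.mem_filter, Finset.mem_range]; have := hM a ha; omega
  rw [this, Finset.card_range]

section Monomials

variable {ι : Type*} [Fintype ι] [DecidableEq ι]

/-- The square-free monomial `∏ i ∈ T, xᵢ` as an `F₂`-valued function on the points `U ⊆ ι`
of the cube. -/
def monomialFun (T : Finset ι) : Finset ι → ZMod 2 := fun U => if T ⊆ U then 1 else 0

/-- The `F₂`-valued functions on the cube of `F₂`-degree at most `m`. -/
def degreeLE (ι : Type*) [Fintype ι] [DecidableEq ι] (m : ℕ) :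
    Submodule (ZMod 2) (Finset ι → ZMod 2) :=
  Submodule.span (ZMod 2) (monomialFun '' {T : Finset ι | T.card ≤ m})

lemma sum_powerset_eq_sum_ite {M : Type*} [AddCommMonoid M] (T : Finset ι) (p : Finset ι → M) :
    ∑ U ∈ T.powerset, p U = ∑ U, if U ⊆ T then p U else 0 := by
  rw [← Finset.sum_filter]
  exact Finset.sum_congr (by ext; simp) fun _ _ => rfl

lemma sum_ite_subset_subset (U W : Finset ι) :
    (∑ T : Finset ι, if U ⊆ T then if T ⊆ W then (1 : ZMod 2) else 0 else 0)
      = if U = W then 1 else 0 := by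
  rw [← card_Icc_zmod_two, Finset.card_eq_sum_ones, Nat.cast_sum]
  simp_rw [← ite_and]
  rw [← Finset.sum_filter]
  refine Finset.sum_congr ?_ (by simp)
  ext T; simp

lemma mem_degreeLE_of_sum_eq_zero {m : ℕ} {p : Finset ι → ZMod 2}
    (h : ∀ T : Finset ι, m < T.card → ∑ U ∈ T.powerset, p U = 0) : p ∈ degreeLE ι m := by
  have key : p = ∑ T : Finset ι, (∑ U ∈ T.powerset, p U) • monomialFun T := by
    funext W
    simp_rw [sum_powerset_eq_sum_ite]
    simp only [Finset.sum_apply, Pi.smul_apply, smul_eq_mul, monomialFun, Finset.sum_mul]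
    rw [Finset.sum_comm]
    have h2 : ∀ U, (∑ T : Finset ι, (if U ⊆ T then p U else 0) * if T ⊆ W then 1 else 0)
        = p U * if U = W then 1 else 0 := by
      intro U
      rw [← sum_ite_subset_subset, Finset.mul_sum]
      exact Finset.sum_congr rfl fun T _ => by split_ifs <;> simp
    simp_rw [h2]
    simp
  rw [key]
  refine Submodule.sum_mem _ fun T _ => ?_
  by_cases hT : m < T.card
  · rw [h T hT, zero_smul]; exact Submodule.zero_mem _
  · exact Submodule.smul_mem _ _ (Submodule.subset_span ⟨T, not_lt.1 hT, rfl⟩)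

lemma sum_powerset_of_mem_degreeLE {m : ℕ} {p : Finset ι → ZMod 2} (hp : p ∈ degreeLE ι m)
    {W : Finset ι} (hW : m < W.card) : ∑ U ∈ W.powerset, p U = 0 := by
  induction hp using Submodule.span_induction with
  | mem x hx =>
    obtain ⟨T, hT, rfl⟩ := hx
    have : ∑ U ∈ W.powerset, monomialFun T U
        = ∑ U : Finset ι, if T ⊆ U then if U ⊆ W then (1 : ZMod 2) else 0 else 0 := by
      rw [sum_powerset_eq_sum_ite]
      refine Finset.sum_congr rfl fun U _ => ?_
      by_cases h1 : U ⊆ W <;> by_cases h2 : T ⊆ U <;> simp [monomialFun, h1, h2]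
    rw [this, sum_ite_subset_subset, if_neg]
    rintro rfl
    exact absurd hW (not_lt.2 hT)
  | zero => simp
  | add x y _ _ hx hy => simp [Finset.sum_add_distrib, hx, hy]
  | smul a x _ hx => simp [← Finset.mul_sum, hx]

lemma eq_zero_of_mem_degreeLE {m : ℕ} {p : Finset ι → ZMod 2} (hp : p ∈ degreeLE ι m)
    (h : ∀ U : Finset ι, U.card ≤ m → p U = 0) : p = 0 := by
  funext W
  induction W using Finset.strongInduction with
  | H W ih =>
    by_cases hW : m < W.card
    · have := sum_powerset_of_mem_degreeLE hp hW
      rwa [Finset.sum_eq_single W] at this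
      · intro U hU hne
        exact ih U (Finset.ssubset_iff_subset_ne.2 ⟨Finset.mem_powerset.1 hU, hne⟩)
      · simp
    · exact h W (not_lt.1 hW)

lemma mul_mem_degreeLE {m d : ℕ} {p q : Finset ι → ZMod 2} (hp : p ∈ degreeLE ι m)
    (hq : q ∈ degreeLE ι d) : p * q ∈ degreeLE ι (m + d) := by
  have h := Submodule.mul_mem_mul hp hq
  rw [degreeLE, degreeLE, Submodule.span_mul_span] at h
  refine Submodule.span_mono ?_ h
  rintro _ ⟨_, ⟨S, hS, rfl⟩, _, ⟨T, hT, rfl⟩, rfl⟩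
  refine ⟨S ∪ T, (Finset.card_union_le S T).trans (add_le_add hS hT), ?_⟩
  funext U
  simp only [monomialFun, Pi.mul_apply, Finset.union_subset_iff, ite_and]
  split_ifs <;> simp

lemma subset_indicator_mem_degreeLE {m : ℕ} {T : Finset ι} (hT : Tᶜ.card ≤ m) :
    (fun U => if U ⊆ T then (1 : ZMod 2) else 0) ∈ degreeLE ι m := by
  have key : (fun U => if U ⊆ T then (1 : ZMod 2) else 0)
      = ∑ W ∈ Tᶜ.powerset, monomialFun W := by
    funext U
    have h := card_Icc_zmod_two ∅ (Tᶜ ∩ U)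
    rw [Finset.sum_apply]
    simp only [monomialFun]
    rw [← Finset.sum_filter, Finset.sum_const, nsmul_eq_mul, mul_one]
    have h3 : Finset.filter (fun W => W ⊆ U) Tᶜ.powerset = Finset.Icc ∅ (Tᶜ ∩ U) := by
      ext W; simp [Finset.subset_inter_iff]
    rw [h3, h]
    have h4 : U ⊆ T ↔ ∅ = Tᶜ ∩ U := by
      rw [eq_comm, ← Finset.disjoint_iff_inter_eq_empty, disjoint_comm,
        disjoint_compl_right_iff]
    simp [h4]
  rw [key]
  refine Submodule.sum_mem _ fun W hW => Submodule.subset_span ⟨W, ?_, rfl⟩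
  exact (Finset.card_le_card (Finset.mem_powerset.1 hW)).trans hT

/-- Functions of degree at most `m` interpolate arbitrary data on the top `m + 1` layers. -/
lemma exists_mem_degreeLE_eq_on_top (m : ℕ) (g : Finset ι → ZMod 2) :
    ∃ q ∈ degreeLE ι m, ∀ U : Finset ι, Uᶜ.card ≤ m → q U = g U := by
  let c : Finset ι → ZMod 2 := fun T => ∑ W, if T ⊆ W then g W else 0
  refine ⟨∑ T ∈ Finset.univ.filter (fun T : Finset ι => Tᶜ.card ≤ m),
    c T • (fun U => if U ⊆ T then (1 : ZMod 2) else 0), ?_, ?_⟩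
  · exact Submodule.sum_mem _ fun T hT => Submodule.smul_mem _ _
      (subset_indicator_mem_degreeLE (Finset.mem_filter.1 hT).2)
  · intro U hU
    have h1 : (∑ T ∈ Finset.univ.filter (fun T : Finset ι => Tᶜ.card ≤ m),
        c T • (fun U => if U ⊆ T then (1 : ZMod 2) else 0)) U
        = ∑ T : Finset ι, c T * if U ⊆ T then 1 else 0 := by
      rw [Finset.sum_apply, Finset.sum_filter]
      refine Finset.sum_congr rfl fun T _ => ?_
      by_cases hUT : U ⊆ T
      · rw [if_pos ((Finset.card_le_card (Finset.compl_subset_compl.2 hUT)).trans hU)]; simp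
      · simp [hUT]
    rw [h1]
    simp only [c, Finset.sum_mul]
    rw [Finset.sum_comm]
    have h2 : ∀ W, (∑ T : Finset ι, (if T ⊆ W then g W else 0) * if U ⊆ T then 1 else 0)
        = g W * if U = W then 1 else 0 := by
      intro W
      rw [← sum_ite_subset_subset, Finset.mul_sum]
      exact Finset.sum_congr rfl fun T _ => by split_ifs <;> simp
    simp_rw [h2]
    simp

/-- If `p` has `F₂`-degree at most `d`, then on its support the top layers are not larger than
the bottom layers, up to a shift by `d`. -/
lemma card_top_le_card_bottom {d : ℕ} {p : Finset ι → ZMod 2} (hp : p ∈ degreeLE ι d) (m : ℕ) :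
    (Finset.univ.filter fun U : Finset ι => p U ≠ 0 ∧ Uᶜ.card ≤ m).card
      ≤ (Finset.univ.filter fun U : Finset ι => p U ≠ 0 ∧ U.card ≤ m + d).card := by
  set B := Finset.univ.filter fun U : Finset ι => p U ≠ 0 ∧ Uᶜ.card ≤ m with hB
  set C := Finset.univ.filter fun U : Finset ι => p U ≠ 0 ∧ U.card ≤ m + d with hC
  let restr (s : Finset (Finset ι)) : degreeLE ι m →ₗ[ZMod 2] (s → ZMod 2) :=
    (LinearMap.funLeft (ZMod 2) (ZMod 2) (Subtype.val : s → Finset ι)).comp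
      (degreeLE ι m).subtype
  have hsurj : Function.Surjective (restr B) := by
    intro g
    obtain ⟨q, hq, hqg⟩ := exists_mem_degreeLE_eq_on_top m
      (fun U => if h : U ∈ B then g ⟨U, h⟩ else 0)
    refine ⟨⟨q, hq⟩, ?_⟩
    funext U
    have hU : (U : Finset ι)ᶜ.card ≤ m := (Finset.mem_filter.1 U.2).2.2
    change q U = g U
    rw [hqg U hU, dif_pos U.2]
  have hker : LinearMap.ker (restr C) ≤ LinearMap.ker (restr B) := by
    rintro ⟨q, hq⟩ hqC
    have h0 : q * p = 0 := by
      refine eq_zero_of_mem_degreeLE (mul_mem_degreeLE hq hp) fun U hU => ?_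
      by_cases hpU : p U = 0
      · simp [hpU]
      · have : q U = 0 := congrFun (LinearMap.mem_ker.1 hqC)
          (⟨U, Finset.mem_filter.2 ⟨Finset.mem_univ _, hpU, hU⟩⟩ : C)
        simp [this]
    rw [LinearMap.mem_ker]
    funext U
    change q U = 0
    have hpU : p U ≠ 0 := (Finset.mem_filter.1 U.2).2.1
    exact (mul_eq_zero.1 (congrFun h0 U)).resolve_right hpU
  have hB' := LinearMap.finrank_range_add_finrank_ker (restr B)
  have hC' := LinearMap.finrank_range_add_finrank_ker (restr C)
  have h1 : Module.finrank (ZMod 2) (LinearMap.range (restr B)) = B.card := by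
    rw [LinearMap.range_eq_top.2 hsurj, finrank_top, Module.finrank_fintype_fun_eq_card,
      Fintype.card_coe]
  have h2 : Module.finrank (ZMod 2) (LinearMap.range (restr C)) ≤ C.card := by
    refine (Submodule.finrank_le _).trans_eq ?_
    rw [Module.finrank_fintype_fun_eq_card, Fintype.card_coe]
  have h3 := Submodule.finrank_mono hker
  omega

/-- The average over the support of a function of `F₂`-degree at most `d` of the sum of the
coordinate signs is at most `d`. -/
lemma sum_card_le_of_mem_degreeLE {d : ℕ} {p : Finset ι → ZMod 2} (hp : p ∈ degreeLE ι d) :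
    ∑ U ∈ Finset.univ.filter (fun U => p U ≠ 0), U.card
      ≤ ∑ U ∈ Finset.univ.filter (fun U => p U ≠ 0), (Uᶜ.card + d) := by
  set A := Finset.univ.filter (fun U => p U ≠ 0) with hA
  have h1 : ∑ U ∈ A, (U.card - d) ≤ ∑ U ∈ A, Uᶜ.card := by
    rw [sum_eq_sum_card_lt A _ (M := Fintype.card ι)
        fun U _ => (Nat.sub_le _ _).trans (Finset.card_le_univ U),
      sum_eq_sum_card_lt A (fun U => Uᶜ.card) (M := Fintype.card ι)
        fun U _ => Finset.card_le_univ _]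
    refine Finset.sum_le_sum fun m _ => ?_
    have h := card_top_le_card_bottom hp m
    rw [← Finset.filter_filter, ← Finset.filter_filter, ← hA] at h
    have ht := Finset.card_filter_add_card_filter_not (s := A) (fun U : Finset ι => Uᶜ.card ≤ m)
    have hb := Finset.card_filter_add_card_filter_not (s := A) (fun U : Finset ι => U.card ≤ m + d)
    simp only [not_le] at ht hb
    have h2 : A.filter (fun U => m < U.card - d) = A.filter (fun U => m + d < U.card) :=
      Finset.filter_congr fun U _ => by omega
    rw [h2]
    omega
  calc ∑ U ∈ A, U.card ≤ ∑ U ∈ A, ((U.card - d) + d) :=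
        Finset.sum_le_sum fun U _ => by omega
    _ ≤ _ := by rw [Finset.sum_add_distrib, Finset.sum_add_distrib]; omega

end Monomials

section Characters

variable {n : ℕ}

/-- The additive character `a ↦ (-1)ᵃ` of `F₂`. -/
def sgn (a : ZMod 2) : ℝ := if a = 0 then 1 else -1

lemma zmod_two_eq_zero_or_one (a : ZMod 2) : a = 0 ∨ a = 1 := by
  revert a; decide

lemma zmod_two_add_self (a : ZMod 2) : a + a = 0 := by
  revert a; decide

@[simp] lemma sgn_zero : sgn 0 = 1 := by simp [sgn]

@[simp] lemma sgn_one : sgn 1 = -1 := by simp [sgn]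

lemma sgn_add (a b : ZMod 2) : sgn (a + b) = sgn a * sgn b := by
  rcases zmod_two_eq_zero_or_one a with rfl | rfl <;>
    rcases zmod_two_eq_zero_or_one b with rfl | rfl <;> simp [zmod_two_add_self]

lemma sgn_sum {κ : Type*} (s : Finset κ) (a : κ → ZMod 2) :
    sgn (∑ i ∈ s, a i) = ∏ i ∈ s, sgn (a i) := by
  induction s using Finset.cons_induction with
  | empty => simp
  | cons i s hi ih => rw [Finset.sum_cons, Finset.prod_cons, sgn_add, ih]

lemma sgn_indicatorVec_dotProduct (S : Finset (Fin n)) (x : Fin n → ZMod 2) :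
    sgn (indicatorVec S ⬝ᵥ x) = ∏ i ∈ S, sgn (x i) := by
  rw [dotProduct, sgn_sum, ← Finset.prod_subset (Finset.subset_univ S)]
  · exact Finset.prod_congr rfl fun i hi => by simp [indicatorVec, hi]
  · intro i _ hi; simp [indicatorVec, hi]

/-- The standard identification of `F₂ⁿ` with the Boolean cube. -/
def boolCube (n : ℕ) : (Fin n → ZMod 2) ≃ (Fin n → Bool) :=
  Equiv.piCongrRight fun _ =>
    { toFun := fun a => decide (a = 1)
      invFun := fun b => if b then 1 else 0
      left_inv := fun a => by revert a; decide
      right_inv := fun b => by revert b; decide }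

lemma signv_boolCube (x : Fin n → ZMod 2) (i : Fin n) : signv (boolCube n x i) = sgn (x i) := by
  change signv (decide (x i = 1)) = _
  rcases zmod_two_eq_zero_or_one (x i) with h | h <;> simp [signv, sgn, h]

lemma fourierCoeff_eq (f : (Fin n → Bool) → ℝ) (S : Finset (Fin n)) :
    fourierCoeff f S
      = (∑ x, f (boolCube n x) * sgn (indicatorVec S ⬝ᵥ x)) / 2 ^ n := by
  rw [fourierCoeff, ← (boolCube n).sum_comp]
  simp_rw [sgn_indicatorVec_dotProduct, signv_boolCube]

lemma sum_sgn_indicatorVec_dotProduct (z : Fin n → ZMod 2) :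
    ∑ S : Finset (Fin n), sgn (indicatorVec S ⬝ᵥ z) = if z = 0 then 2 ^ n else 0 := by
  simp_rw [sgn_indicatorVec_dotProduct]
  rw [← Finset.powerset_univ, ← Finset.prod_one_add]
  split_ifs with h
  · subst h; simp [one_add_one_eq_two]
  · obtain ⟨i, hi⟩ := Function.ne_iff.1 h
    refine Finset.prod_eq_zero (Finset.mem_univ i) ?_
    rw [(zmod_two_eq_zero_or_one (z i)).resolve_left hi]; simp

lemma sum_sgn_dotProduct {w : Fin n → ZMod 2} (hw : w ≠ 0) :
    ∑ x : Fin n → ZMod 2, sgn (w ⬝ᵥ x) = 0 := by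
  obtain ⟨i, hi⟩ := Function.ne_iff.1 hw
  have h := Equiv.sum_comp (Equiv.addRight (Pi.single i 1 : Fin n → ZMod 2))
    (fun x : Fin n → ZMod 2 => sgn (w ⬝ᵥ x))
  have hi' : w i = 1 := (zmod_two_eq_zero_or_one (w i)).resolve_left hi
  simp only [Equiv.coe_addRight, dotProduct_add, sgn_add, dotProduct_single, hi', mul_one,
    sgn_one, mul_neg, Finset.sum_neg_distrib] at h
  linarith

lemma eq_sum_fourierCoeff (f : (Fin n → Bool) → ℝ) (x : Fin n → ZMod 2) :
    f (boolCube n x) = ∑ S, fourierCoeff f S * sgn (indicatorVec S ⬝ᵥ x) := by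
  have hadd : ∀ y : Fin n → ZMod 2, y + x = 0 ↔ y = x := by
    intro y
    rw [add_eq_zero_iff_eq_neg, show -x = x from funext fun i => CharTwo.neg_eq (x i)]
  simp_rw [fourierCoeff_eq, div_mul_eq_mul_div, ← Finset.sum_div, Finset.sum_mul]
  rw [Finset.sum_comm]
  simp_rw [mul_assoc, ← sgn_add, ← dotProduct_add, ← Finset.mul_sum,
    sum_sgn_indicatorVec_dotProduct, hadd]
  simp

/-- A nonzero Fourier coefficient of the restriction of `f` to the affine subcube
`x₀ + span (vᵢ : i ∈ T)` comes from a set in the Fourier support of `f`. -/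
lemma exists_mem_fourierSupport_of_sum_ne_zero {ι : Type*} [DecidableEq ι]
    (f : (Fin n → Bool) → ℝ)
    (x₀ : Fin n → ZMod 2) (v : ι → Fin n → ZMod 2) (T : Finset ι) (a : ι → ZMod 2)
    (h : ∑ U ∈ T.powerset, f (boolCube n (x₀ + ∑ i ∈ U, v i)) * ∏ i ∈ U, sgn (a i) ≠ 0) :
    ∃ S ∈ fourierSupport f, ∀ i ∈ T, indicatorVec S ⬝ᵥ v i = a i := by
  by_contra! hcon
  refine h ?_
  simp_rw [eq_sum_fourierCoeff, Finset.sum_mul]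
  rw [Finset.sum_comm]
  refine Finset.sum_eq_zero fun S _ => ?_
  by_cases hS : S ∈ fourierSupport f
  · obtain ⟨i, hi, hne⟩ := hcon S hS
    have hterm : ∀ U ∈ T.powerset,
        fourierCoeff f S * sgn (indicatorVec S ⬝ᵥ (x₀ + ∑ i ∈ U, v i)) * ∏ i ∈ U, sgn (a i)
          = fourierCoeff f S * sgn (indicatorVec S ⬝ᵥ x₀) *
            ∏ i ∈ U, sgn (indicatorVec S ⬝ᵥ v i + a i) := by
      intro U _
      simp_rw [dotProduct_add, dotProduct_sum, sgn_add, sgn_sum, Finset.prod_mul_distrib]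
      ring
    rw [Finset.sum_congr rfl hterm, ← Finset.mul_sum, ← Finset.prod_one_add]
    refine mul_eq_zero_of_right _ (Finset.prod_eq_zero hi ?_)
    have : indicatorVec S ⬝ᵥ v i + a i = 1 := by
      generalize indicatorVec S ⬝ᵥ v i = b at hne ⊢
      generalize a i = c at hne ⊢
      revert b c; decide
    simp [this]
  · have : fourierCoeff f S = 0 := by simpa [fourierSupport] using hS
    simp [this]

/-- The `F₂`-valued version of a `±1`-valued function on `F₂ⁿ`: the indicator of `f = -1`. -/
def negIndicator (f : (Fin n → Bool) → ℝ) (x : Fin n → ZMod 2) : ZMod 2 :=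
  if f (boolCube n x) = -1 then 1 else 0

lemma sum_mul_sgn_ne_zero {ι : Type*} [DecidableEq ι] {T : Finset ι} (hT : 2 ≤ T.card)
    {F : Finset ι → ℝ} (hF : ∀ U, F U = 1 ∨ F U = -1)
    (hodd : ∑ U ∈ T.powerset, (if F U = -1 then (1 : ZMod 2) else 0) ≠ 0) (a : ι → ZMod 2) :
    ∑ U ∈ T.powerset, F U * ∏ i ∈ U, sgn (a i) ≠ 0 := by
  let s : ι → ℤ := fun i => if a i = 0 then 1 else -1
  let q : Finset ι → ℤ := fun U => if F U = -1 then 1 else 0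
  have hs : ∀ i, sgn (a i) = s i := fun i => by simp only [sgn, s]; split_ifs <;> simp
  have hq : ∀ U, F U = ((1 - 2 * q U : ℤ) : ℝ) := fun U => by
    rcases hF U with h | h <;> simp only [q, h] <;> norm_num
  have hcast : ∑ U ∈ T.powerset, F U * ∏ i ∈ U, sgn (a i)
      = ((∑ U ∈ T.powerset, (1 - 2 * q U) * ∏ i ∈ U, s i : ℤ) : ℝ) := by
    simp_rw [hs, hq]; push_cast; rfl
  rw [hcast, Int.cast_ne_zero]
  have hsplit : ∑ U ∈ T.powerset, (1 - 2 * q U) * ∏ i ∈ U, s i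
      = ∏ i ∈ T, (1 + s i) - 2 * ∑ U ∈ T.powerset, q U * ∏ i ∈ U, s i := by
    rw [Finset.prod_one_add, Finset.mul_sum, ← Finset.sum_sub_distrib]
    exact Finset.sum_congr rfl fun U _ => by ring
  have h4 : (4 : ℤ) ∣ ∏ i ∈ T, (1 + s i) := by
    have h2 : ∏ i ∈ T, (2 : ℤ) ∣ ∏ i ∈ T, (1 + s i) :=
      Finset.prod_dvd_prod_of_dvd _ _ fun i _ => by simp only [s]; split_ifs <;> norm_num
    rw [Finset.prod_const] at h2
    exact (pow_dvd_pow (2 : ℤ) hT).trans h2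
  have hodd' : ((∑ U ∈ T.powerset, q U * ∏ i ∈ U, s i : ℤ) : ZMod 2) ≠ 0 := by
    convert hodd using 1
    push_cast
    refine Finset.sum_congr rfl fun U _ => ?_
    have : ∀ i, ((s i : ℤ) : ZMod 2) = 1 := fun i => by
      simp only [s]; split_ifs <;> simp
    simp [this, q]
  rw [hsplit]
  intro h0
  apply hodd'
  rw [ZMod.intCast_zmod_eq_zero_iff_dvd _ 2]
  push_cast
  omega

/-- The restriction of a function of Fourier sparsity `k` to an affine subspace has `F₂`-degree at
most `log₂ k`. -/
lemma negIndicator_mem_degreeLE {ι : Type*} [Fintype ι] [DecidableEq ι]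
    {f : (Fin n → Bool) → ℝ} (hf : IsBooleanFunc f)
    (hk : 1 < sparsity f) (x₀ : Fin n → ZMod 2) (v : ι → Fin n → ZMod 2) :
    (fun U : Finset ι => negIndicator f (x₀ + ∑ i ∈ U, v i))
      ∈ degreeLE ι (Nat.log 2 (sparsity f)) := by
  refine mem_degreeLE_of_sum_eq_zero fun T hT => ?_
  by_contra hodd
  have hlog : 1 ≤ Nat.log 2 (sparsity f) := Nat.log_pos one_lt_two hk
  have hne := sum_mul_sgn_ne_zero (by omega)
    (F := fun U => f (boolCube n (x₀ + ∑ i ∈ U, v i))) (fun U => hf _) hodd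
  have hcard : T.powerset.card ≤ (fourierSupport f).card := by
    refine Finset.card_le_card_of_surjOn
      (fun S => T.filter fun i => indicatorVec S ⬝ᵥ v i = 1) ?_
    intro W hW
    obtain ⟨S, hS, hSW⟩ := exists_mem_fourierSupport_of_sum_ne_zero f x₀ v T
      (fun i => if i ∈ W then 1 else 0) (hne _)
    refine ⟨S, hS, ?_⟩
    have hWT : W ⊆ T := by simpa using hW
    ext i
    simp only [Finset.mem_filter]
    constructor
    · rintro ⟨hi, h1⟩
      rw [hSW i hi] at h1
      by_contra hiW
      simp [hiW] at h1
    · intro hi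
      exact ⟨hWT hi, by rw [hSW i (hWT hi), if_pos hi]⟩
  rw [Finset.card_powerset] at hcard
  exact absurd hT (not_lt.2 (Nat.le_log_of_pow_le one_lt_two hcard))

end Characters

section LevelOne

variable {n : ℕ} {ι : Type*}

lemma exists_dual_vectors [Fintype ι] [DecidableEq ι] {w : ι → Fin n → ZMod 2}
    (hw : LinearIndependent (ZMod 2) w) :
    ∃ v : ι → Fin n → ZMod 2, ∀ i j, w i ⬝ᵥ v j = if i = j then 1 else 0 := by
  have hrank : (Matrix.of w).rank = Fintype.card ι := LinearIndependent.rank_matrix hw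
  have htop : LinearMap.range (Matrix.of w).mulVecLin = ⊤ := by
    refine Submodule.eq_top_of_finrank_eq ?_
    rw [Module.finrank_fintype_fun_eq_card]
    exact hrank
  choose v hv using fun j => LinearMap.range_eq_top.1 htop (Pi.single j 1)
  refine ⟨v, fun i j => ?_⟩
  have := congrFun (hv j) i
  rw [Pi.single_apply] at this
  exact this

lemma sum_symmDiff_zmod_two [DecidableEq ι] (v : ι → Fin n → ZMod 2) (U E : Finset ι) :
    ∑ i ∈ symmDiff U E, v i = ∑ i ∈ U, v i + ∑ i ∈ E, v i := by
  have hI : ∑ i ∈ U ∩ E, v i + ∑ i ∈ U ∩ E, v i = 0 :=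
    funext fun _ => zmod_two_add_self _
  have h1 := Finset.sum_inter_add_sum_sdiff U E v
  have h2 := Finset.sum_inter_add_sum_sdiff E U v
  rw [Finset.inter_comm] at h2
  rw [symmDiff_def, Finset.sup_eq_union, Finset.sum_union disjoint_sdiff_sdiff, ← h1, ← h2]
  calc _ = (∑ i ∈ U ∩ E, v i + ∑ i ∈ U ∩ E, v i) + (∑ i ∈ U \ E, v i + ∑ i ∈ E \ U, v i) := by
        rw [hI, zero_add]
    _ = _ := by abel

/-- A function on `F₂ⁿ` has nonpositive sum if it does so on each translate of
`span (vᵢ)`, based at the point where the dual functionals `wᵢ` take prescribed values `eᵢ`. -/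
lemma sum_nonpos_of_sum_subcube_nonpos [Fintype ι] [DecidableEq ι] {w v : ι → Fin n → ZMod 2}
    (hwv : ∀ i j, w i ⬝ᵥ v j = if i = j then 1 else 0) (e : ι → ZMod 2)
    {H : (Fin n → ZMod 2) → ℝ}
    (hH : ∀ x₀, (∀ i, w i ⬝ᵥ x₀ = e i) → ∑ U : Finset ι, H (x₀ + ∑ i ∈ U, v i) ≤ 0) :
    ∑ x, H x ≤ 0 := by
  have h1 : ∀ x, ∑ U : Finset ι, H (x + ∑ i ∈ U, v i) ≤ 0 := by
    intro x
    let E : Finset ι := Finset.univ.filter fun i => w i ⬝ᵥ x + e i = 1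
    have h := hH (x + ∑ i ∈ E, v i) fun i => by
      simp only [dotProduct_add, dotProduct_sum, hwv, Finset.sum_ite_eq, E, Finset.mem_filter,
        Finset.mem_univ, true_and]
      generalize w i ⬝ᵥ x = a
      generalize e i = b
      revert a b; decide
    refine le_of_eq_of_le ?_ h
    have hinv : Function.Involutive fun U : Finset ι => symmDiff U E :=
      fun U => symmDiff_symmDiff_cancel_right E U
    rw [← Equiv.sum_comp (hinv.toPerm _)]
    refine Finset.sum_congr rfl fun U _ => ?_
    rw [Function.Involutive.coe_toPerm, sum_symmDiff_zmod_two]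
    congr 1
    abel
  have h2 : ∑ x, ∑ U : Finset ι, H (x + ∑ i ∈ U, v i)
      = (Fintype.card (Finset ι) : ℝ) * ∑ x, H x := by
    rw [Finset.sum_comm]
    have : ∀ U : Finset ι, ∑ x, H (x + ∑ i ∈ U, v i) = ∑ x, H x := fun U =>
      Equiv.sum_comp (Equiv.addRight (∑ i ∈ U, v i)) H
    simp_rw [this]
    rw [Finset.sum_const, nsmul_eq_mul, Finset.card_univ]
  have h3 : (Fintype.card (Finset ι) : ℝ) * ∑ x, H x ≤ 0 :=
    h2 ▸ Finset.sum_nonpos fun x _ => h1 x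
  have h4 : (0 : ℝ) < Fintype.card (Finset ι) := by exact_mod_cast Fintype.card_pos
  exact nonpos_of_mul_nonpos_right h3 h4

/-- Level-one inequality for sparse functions: the absolute Fourier coefficients at linearly
independent sets sum to at most `2 δ(f) log₂ k(f)`. -/
lemma sum_abs_fourierCoeff_le [Fintype ι] {f : (Fin n → Bool) → ℝ}
    (hf : IsBooleanFunc f) (hk : 1 < sparsity f) {S : ι → Finset (Fin n)}
    (hS : LinearIndependent (ZMod 2) fun i => indicatorVec (S i)) :
    ∑ i, |fourierCoeff f (S i)| ≤ 2 * Nat.log 2 (sparsity f) * weight f := by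
  set d := Nat.log 2 (sparsity f) with hd
  let w : ι → Fin n → ZMod 2 := fun i => indicatorVec (S i)
  obtain ⟨v, hwv⟩ := exists_dual_vectors hS
  let e : ι → ZMod 2 := fun i => if 0 ≤ fourierCoeff f (S i) then 0 else 1
  let g : (Fin n → ZMod 2) → ℝ := fun x => if negIndicator f x ≠ 0 then 1 else 0
  have hg : ∀ x, f (boolCube n x) = 1 - 2 * g x := by
    intro x
    rcases hf (boolCube n x) with h | h <;> simp only [g, negIndicator, h] <;> norm_num
  have hweight : weight f = (∑ x, g x) / 2 ^ n := by
    rw [weight, Finset.card_filter, ← (boolCube n).sum_comp]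
    push_cast
    congr 1
    refine Finset.sum_congr rfl fun x _ => ?_
    simp only [g, negIndicator]
    split_ifs <;> simp_all
  have hcoeff : ∀ i, |fourierCoeff f (S i)|
      = (∑ x, g x * (-2 * sgn (e i + w i ⬝ᵥ x))) / 2 ^ n := by
    intro i
    have h1 : |fourierCoeff f (S i)| = sgn (e i) * fourierCoeff f (S i) := by
      by_cases h : 0 ≤ fourierCoeff f (S i)
      · simp [e, h, abs_of_nonneg]
      · simp [e, h, abs_of_neg (not_le.1 h)]
    rw [h1, fourierCoeff_eq]
    simp_rw [hg, sub_mul, one_mul, Finset.sum_sub_distrib]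
    rw [sum_sgn_dotProduct (hS.ne_zero i), zero_sub, ← mul_div_assoc, ← Finset.sum_neg_distrib,
      Finset.mul_sum]
    simp_rw [sgn_add]
    congr 1
    exact Finset.sum_congr rfl fun x _ => by ring
  have key : ∑ x, g x * (∑ i, -sgn (e i + w i ⬝ᵥ x) - d) ≤ 0 := by
    refine sum_nonpos_of_sum_subcube_nonpos hwv e fun x₀ hx₀ => ?_
    have hsum : ∀ U : Finset ι, ∑ i, -sgn (e i + w i ⬝ᵥ (x₀ + ∑ j ∈ U, v j))
        = U.card - (Uᶜ.card : ℝ) := by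
      intro U
      have hterm : ∀ i, -sgn (e i + w i ⬝ᵥ (x₀ + ∑ j ∈ U, v j))
          = (if i ∈ U then 1 else 0) - if i ∈ Uᶜ then 1 else 0 := by
        intro i
        have : w i ⬝ᵥ (x₀ + ∑ j ∈ U, v j) = e i + if i ∈ U then 1 else 0 := by
          rw [dotProduct_add, hx₀ i, dotProduct_sum]
          simp only [w, hwv, Finset.sum_ite_eq]
        rw [this, ← add_assoc, zmod_two_add_self, zero_add]
        by_cases hi : i ∈ U <;> simp [hi]
      simp_rw [hterm, Finset.sum_sub_distrib]
      simp only [Finset.sum_ite_mem, Finset.univ_inter, Finset.sum_const, nsmul_eq_mul, mul_one]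
    have hcard := sum_card_le_of_mem_degreeLE (negIndicator_mem_degreeLE hf hk x₀ v)
    have hcard' : (∑ U ∈ Finset.univ.filter
          (fun U : Finset ι => negIndicator f (x₀ + ∑ i ∈ U, v i) ≠ 0), (U.card : ℝ))
        ≤ ∑ U ∈ Finset.univ.filter
          (fun U : Finset ι => negIndicator f (x₀ + ∑ i ∈ U, v i) ≠ 0), ((Uᶜ.card : ℝ) + d) := by
      exact_mod_cast hcard
    rw [← sub_nonpos, ← Finset.sum_sub_distrib, Finset.sum_filter] at hcard'
    refine le_of_eq_of_le (Finset.sum_congr rfl fun U _ => ?_) hcard'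
    rw [hsum U]
    simp only [g]
    split_ifs <;> ring
  simp_rw [hcoeff]
  rw [← Finset.sum_div, Finset.sum_comm, hweight, ← mul_div_assoc]
  refine div_le_div_of_nonneg_right ?_ (by positivity)
  have hkey : ∑ x, g x * (∑ i, -sgn (e i + w i ⬝ᵥ x) - d)
      = (∑ x, ∑ i, g x * (-2 * sgn (e i + w i ⬝ᵥ x))) / 2 - d * ∑ x, g x := by
    rw [Finset.sum_div, Finset.mul_sum, ← Finset.sum_sub_distrib]
    refine Finset.sum_congr rfl fun x _ => ?_
    rw [mul_sub, Finset.mul_sum, Finset.sum_div, mul_comm (d : ℝ)]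
    congr 1
    exact Finset.sum_congr rfl fun i _ => by ring
  linarith

/-- If the sets with Fourier coefficient at least `1 / t` in absolute value span the Fourier
support, then `r(f) ≤ 2 δ(f) log₂ k(f) · t`. -/
lemma fourierRank_le_mul {f : (Fin n → Bool) → ℝ} (hf : IsBooleanFunc f)
    (hk : 1 < sparsity f) {t : ℝ} (ht : 0 < t) (hlevel : levelDim f t = fourierRank f) :
    (fourierRank f : ℝ) ≤ 2 * Nat.log 2 (sparsity f) * weight f * t := by
  obtain ⟨b, hb, hspan, hli⟩ := exists_linearIndependent (ZMod 2)
    (indicatorVec '' {S : Finset (Fin n) | 1 / t ≤ |fourierCoeff f S|})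
  choose S hS hSb using fun x : b => hb x.2
  have hcard : fourierRank f = Fintype.card b := by
    rw [← hlevel, levelDim, ← hspan, ← finrank_span_eq_card hli, Subtype.range_coe]
  have hsum := sum_abs_fourierCoeff_le hf hk (S := S) (by simpa only [hSb] using hli)
  have hlow : (Fintype.card b : ℝ) * (1 / t) ≤ ∑ x, |fourierCoeff f (S x)| := by
    rw [← nsmul_eq_mul, ← Finset.card_univ]
    exact Finset.card_nsmul_le_sum _ _ _ fun x _ => hS x
  rw [hcard]
  have := hlow.trans hsum
  rwa [mul_one_div, div_le_iff₀ ht] at this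

end LevelOne

/-- **Lemma.** There is a universal constant `c > 0` such that every Boolean function
`f` with `k(f) > 1` satisfies `δ(f) ≥ c · r(f)/(k''(f) · log₂ k(f))`. -/
theorem delta_lower_bound_maxRankEntropy :
    ∃ c : ℝ, 0 < c ∧
      ∀ (n : ℕ), 0 < n → ∀ f : (Fin n → Bool) → ℝ, IsBooleanFunc f →
        1 < sparsity f →
        c * ((fourierRank f : ℝ) / (maxRankEntropy f * Real.logb 2 (sparsity f)))
          ≤ weight f := by
  refine ⟨1 / 2, by norm_num, fun n _ f hf hk => ?_⟩
  have hw : 0 ≤ weight f := by unfold weight; positivity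
  have hlogk : (1 : ℝ) ≤ Real.logb 2 (sparsity f) := by
    rw [Real.le_logb_iff_rpow_le one_lt_two (by positivity), Real.rpow_one]
    exact_mod_cast hk
  rcases le_or_gt (maxRankEntropy f) 0 with ht | ht
  · refine le_trans ?_ hw
    exact mul_nonpos_of_nonneg_of_nonpos (by norm_num)
      (div_nonpos_of_nonneg_of_nonpos (by positivity)
        (mul_nonpos_of_nonpos_of_nonneg ht (by linarith)))
  · have hne : {t : ℝ | 0 < t ∧ levelDim f t = fourierRank f}.Nonempty := by
      by_contra hempty
      rw [maxRankEntropy, Set.not_nonempty_iff_eq_empty.1 hempty, Real.sInf_empty] at ht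
      exact lt_irrefl _ ht
    have hrank : (fourierRank f : ℝ)
        ≤ 2 * Real.logb 2 (sparsity f) * weight f * maxRankEntropy f := by
      have hstep : ∀ t ∈ {t : ℝ | 0 < t ∧ levelDim f t = fourierRank f},
          (fourierRank f : ℝ) ≤ 2 * Real.logb 2 (sparsity f) * weight f * t := by
        rintro t ⟨ht0, htl⟩
        refine (fourierRank_le_mul hf hk ht0 htl).trans ?_
        have := Real.natLog_le_logb (sparsity f) 2
        push_cast at this
        gcongr
      rcases hw.eq_or_lt with h0 | hpos
      · obtain ⟨t, htm⟩ := hne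
        simpa [← h0] using hstep t htm
      · have hc : 0 < 2 * Real.logb 2 (sparsity f) * weight f := by positivity
        rw [← div_le_iff₀' hc]
        exact le_csInf hne fun t htm => (div_le_iff₀' hc).2 (hstep t htm)
    rw [← mul_div_assoc, div_le_iff₀ (by positivity)]
    linarith

end BoolFunc

end
end

section
/- There exists a universal constant C > 0 such that for every positive integer n and every Boolean function f : {-1,1}^n → {-1,1}, the sum of the absolute values of the level-1 Fourier coefficients satisfies Σ_{i=1}^{n} |f̂({i})| ≤ C · δ(f) · deg₂(f). -/
open scoped BigOperators
open scoped Classical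

noncomputable section

namespace BoolFunc

/-- Coefficient of the monomial `∏_{i ∈ S} zᵢ` in the unique multilinear `F₂`-polynomial
representing `f` under the identification `-1 ↦ 1, 1 ↦ 0` of `{-1,1}` with `F₂`
(a coordinate `xᵢ = true` stands for `-1`, i.e. for the bit `1`). -/
def f2Coeff {n : ℕ} (f : (Fin n → Bool) → ℝ) (S : Finset (Fin n)) : ZMod 2 :=
  ∑ x ∈ Finset.univ.filter (fun x : Fin n → Bool => ∀ i, x i = true → i ∈ S),
    (if f x = -1 then 1 else 0)

/-- The `F₂`-degree `deg₂(f)`. -/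
def f2Degree {n : ℕ} (f : (Fin n → Bool) → ℝ) : ℕ :=
  (Finset.univ.filter (fun S : Finset (Fin n) => f2Coeff f S ≠ 0)).sup Finset.card

/-- The coordinates on which `x` and `z` differ. -/
def diffSet {n : ℕ} (z x : Fin n → Bool) : Finset (Fin n) :=
  Finset.univ.filter (fun i => x i ≠ z i)

theorem diffSet_injective {n : ℕ} (z : Fin n → Bool) : Function.Injective (diffSet z) := by
  intro x y h
  funext i
  have hi : x i ≠ z i ↔ y i ≠ z i := by
    simpa [diffSet] using congrArg (fun s => i ∈ s) h
  cases hx : x i <;> cases hy : y i <;> cases hz : z i <;> simp_all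

theorem diffSet_card_le {n : ℕ} (z x : Fin n → Bool) : (diffSet z x).card ≤ n := by
  simpa using Finset.card_le_univ (diffSet z x)

/-- The points at which `f` takes the value `-1`. -/
def negSet {n : ℕ} (f : (Fin n → Bool) → ℝ) : Finset (Fin n → Bool) :=
  Finset.univ.filter (fun x => f x = -1)

theorem f2Coeff_eq_zero_of_f2Degree_lt {n : ℕ} (f : (Fin n → Bool) → ℝ) (S : Finset (Fin n))
    (h : f2Degree f < S.card) : f2Coeff f S = 0 := by
  by_contra hS
  have : S.card ≤ f2Degree f := Finset.le_sup (f := Finset.card) (by simpa using hS)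
  omega

/-- The `F₂`-sum of `f` vanishes on every subcube, with free coordinates `V` and the other
coordinates given by the indicator of `W`, whose dimension exceeds the degree. -/
theorem sum_subcube_eq_zero {n : ℕ} (f : (Fin n → Bool) → ℝ) (W : Finset (Fin n)) :
    ∀ V : Finset (Fin n), Disjoint V W → f2Degree f < V.card →
      ∑ x ∈ Finset.univ.filter (fun x : Fin n → Bool => ∀ i, i ∉ V → (x i = true ↔ i ∈ W)),
        (if f x = -1 then (1 : ZMod 2) else 0) = 0 := by
  induction W using Finset.induction_on with
  | empty =>
    intro V _ hV
    refine Eq.trans ?_ (f2Coeff_eq_zero_of_f2Degree_lt f V hV)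
    rw [f2Coeff]
    congr 1
    ext x
    simp only [Finset.mem_filter, Finset.mem_univ, true_and, Finset.notMem_empty, iff_false]
    exact forall_congr' fun i => not_imp_not
  | insert a W ha ih =>
    intro V hVW hV
    have haV : a ∉ V := fun h => Finset.disjoint_left.mp hVW h (Finset.mem_insert_self a W)
    have hVW' : Disjoint V W := hVW.mono_right (Finset.subset_insert a W)
    have hsmall := ih V hVW' hV
    have hlarge := ih (insert a V) (Finset.disjoint_insert_left.mpr ⟨ha, hVW'⟩)
      (by rw [Finset.card_insert_of_notMem haV]; omega)
    have hunion : Finset.univ.filter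
          (fun x : Fin n → Bool => ∀ i, i ∉ insert a V → (x i = true ↔ i ∈ W)) =
        Finset.univ.filter
          (fun x : Fin n → Bool => ∀ i, i ∉ V → (x i = true ↔ i ∈ insert a W)) ∪
        Finset.univ.filter (fun x : Fin n → Bool => ∀ i, i ∉ V → (x i = true ↔ i ∈ W)) := by
      ext x
      simp only [Finset.mem_filter, Finset.mem_univ, true_and, Finset.mem_union,
        Finset.mem_insert, not_or]
      constructor
      · intro h
        by_cases hxa : x a = true
        · left
          intro i hi
          by_cases hia : i = a
          · simp [hia, hxa]
          · simpa [hia] using h i ⟨hia, hi⟩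
        · right
          intro i hi
          by_cases hia : i = a
          · simp [hia, hxa, ha]
          · exact h i ⟨hia, hi⟩
      · rintro (h | h) i ⟨hia, hi⟩
        · simpa [hia] using h i hi
        · exact h i hi
    have hdisj : Disjoint
        (Finset.univ.filter
          (fun x : Fin n → Bool => ∀ i, i ∉ V → (x i = true ↔ i ∈ insert a W)))
        (Finset.univ.filter
          (fun x : Fin n → Bool => ∀ i, i ∉ V → (x i = true ↔ i ∈ W))) := by
      rw [Finset.disjoint_left]
      intro x hx hx'
      simp only [Finset.mem_filter, Finset.mem_univ, true_and] at hx hx'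
      exact ha ((hx' a haV).mp ((hx a haV).mpr (Finset.mem_insert_self a W)))
    rw [hunion, Finset.sum_union hdisj, hsmall, add_zero] at hlarge
    exact hlarge

theorem sum_superset_diffSet_eq_zero {n : ℕ} (f : (Fin n → Bool) → ℝ) (z : Fin n → Bool)
    (U : Finset (Fin n)) (hU : U.card + f2Degree f < n) :
    ∑ x ∈ negSet f, (if U ⊆ diffSet z x then (1 : ZMod 2) else 0) = 0 := by
  have h := sum_subcube_eq_zero f (U.filter fun i => z i = false) Uᶜ
    (Finset.disjoint_left.mpr fun i hi hi' =>
      Finset.mem_compl.mp hi (Finset.mem_filter.mp hi').1)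
    (by rw [Finset.card_compl, Fintype.card_fin]; omega)
  refine Eq.trans ?_ h
  rw [negSet, Finset.sum_filter, Finset.sum_filter]
  refine Finset.sum_congr rfl fun x _ => ?_
  have hiff : U ⊆ diffSet z x ↔
      ∀ i, i ∉ Uᶜ → (x i = true ↔ i ∈ U.filter fun i => z i = false) := by
    simp only [Finset.subset_iff, diffSet, Finset.mem_filter, Finset.mem_univ, true_and,
      Finset.mem_compl, not_not]
    refine forall_congr' fun i => imp_congr_right fun hi => ?_
    cases x i <;> cases z i <;> simp [hi]
  by_cases h1 : f x = -1 <;> by_cases h2 : U ⊆ diffSet z x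
  · simp only [h1, if_true, if_pos h2, if_pos (hiff.mp h2)]
  · simp only [h1, if_true, if_neg h2, if_neg (mt hiff.mpr h2)]
  · simp [h1]
  · simp [h1]

/-- The points of `A` at distance at most `k` from `z`. -/
def nearSet {n : ℕ} (A : Finset (Fin n → Bool)) (z : Fin n → Bool) (k : ℕ) :
    Finset (Fin n → Bool) :=
  A.filter (fun x => (diffSet z x).card ≤ k)

/-- The evaluation matrix on `A` of the monomials supported on `diffSet z y`, where `y` ranges
over the points of `A` near `z`. -/
def monomialMatrix {n : ℕ} (A : Finset (Fin n → Bool)) (z : Fin n → Bool) (k : ℕ) :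
    Matrix (nearSet A z k) A (ZMod 2) :=
  fun y x => if diffSet z y.1 ⊆ diffSet z x.1 then 1 else 0

theorem linearIndependent_monomialMatrix {n : ℕ} (A : Finset (Fin n → Bool))
    (z : Fin n → Bool) (k : ℕ) :
    LinearIndependent (ZMod 2) (monomialMatrix A z k).row := by
  rw [Fintype.linearIndependent_iff]
  intro c hc
  have key : ∀ m : ℕ, ∀ y : nearSet A z k, (diffSet z y.1).card = m → c y = 0 := by
    intro m
    induction m using Nat.strong_induction_on with
    | _ m ih =>
      intro y hy
      have hyA : y.1 ∈ A := (Finset.mem_filter.mp y.2).1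
      have hev := congrFun hc ⟨y.1, hyA⟩
      rw [Finset.sum_apply, Finset.sum_eq_single y] at hev
      · simpa [Matrix.row, monomialMatrix] using hev
      · intro w _ hw
        by_cases hsub : diffSet z w.1 ⊆ diffSet z y.1
        · have hne : diffSet z w.1 ≠ diffSet z y.1 := fun h =>
            hw (Subtype.ext (diffSet_injective z h))
          have hlt := Finset.card_lt_card (hsub.ssubset_of_ne hne)
          simp [ih _ (hy ▸ hlt) w rfl]
        · simp [Matrix.row, monomialMatrix, hsub]
      · simp
  exact fun y => key _ y rfl

theorem nearSet_card_add_le {n : ℕ} (f : (Fin n → Bool) → ℝ) (z : Fin n → Bool) (k l : ℕ)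
    (h : k + l + f2Degree f < n) :
    (nearSet (negSet f) z k).card + (nearSet (negSet f) z l).card ≤ (negSet f).card := by
  have hmul : monomialMatrix (negSet f) z k * (monomialMatrix (negSet f) z l).transpose = 0 := by
    ext y w
    have hy := (Finset.mem_filter.mp y.2).2
    have hw := (Finset.mem_filter.mp w.2).2
    have hU := Finset.card_union_le (diffSet z y.1) (diffSet z w.1)
    rw [Matrix.zero_apply, ← sum_superset_diffSet_eq_zero f z
      (diffSet z y.1 ∪ diffSet z w.1) (by omega), Matrix.mul_apply,
      ← Finset.sum_coe_sort (negSet f)]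
    refine Finset.sum_congr rfl fun x _ => ?_
    simp only [Matrix.transpose_apply, monomialMatrix, Finset.union_subset_iff, ite_and]
    split_ifs <;> simp
  have hrank := Matrix.rank_add_rank_le_card_of_mul_eq_zero hmul
  rwa [Matrix.rank_transpose, (linearIndependent_monomialMatrix _ z k).rank_matrix,
    (linearIndependent_monomialMatrix _ z l).rank_matrix, Fintype.card_coe, Fintype.card_coe,
    Fintype.card_coe] at hrank

theorem sum_nearSet_card {n : ℕ} (A : Finset (Fin n → Bool)) (z : Fin n → Bool) (m : ℕ) :
    ∑ k ∈ Finset.range m, (nearSet A z k).card = ∑ x ∈ A, (m - (diffSet z x).card) := by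
  simp only [nearSet, Finset.card_filter]
  rw [Finset.sum_comm]
  refine Finset.sum_congr rfl fun x _ => ?_
  rw [← Finset.card_filter, ← Nat.card_Ico]
  congr 1
  ext k
  simp [and_comm]

theorem two_mul_sum_sub_diffSet_card_le {n : ℕ} (f : (Fin n → Bool) → ℝ) (z : Fin n → Bool) :
    2 * ∑ x ∈ negSet f, (n - f2Degree f - (diffSet z x).card) ≤
      (n - f2Degree f) * (negSet f).card := by
  set m := n - f2Degree f with hm
  rw [← sum_nearSet_card, two_mul]
  nth_rewrite 2 [← Finset.sum_range_reflect]
  rw [← Finset.sum_add_distrib]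
  refine (Finset.sum_le_card_nsmul _ _ (negSet f).card fun k hk => ?_).trans_eq (by simp)
  have := Finset.mem_range.mp hk
  exact nearSet_card_add_le f z k (m - 1 - k) (by omega)

/-- The average distance from `z` of a point of `negSet f` is at least `(n - deg₂ f) / 2`. -/
theorem sum_sub_two_mul_diffSet_card_le {n : ℕ} (f : (Fin n → Bool) → ℝ) (z : Fin n → Bool) :
    ∑ x ∈ negSet f, ((n : ℝ) - 2 * (diffSet z x).card) ≤ (negSet f).card * f2Degree f := by
  have h : (2 : ℝ) * ∑ x ∈ negSet f, ((n - f2Degree f - (diffSet z x).card : ℕ) : ℝ) ≤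
      ((n - f2Degree f : ℕ) : ℝ) * (negSet f).card := by
    exact_mod_cast two_mul_sum_sub_diffSet_card_le f z
  set m := n - f2Degree f with hm
  have hn : (n : ℝ) ≤ m + f2Degree f := by
    have : n ≤ m + f2Degree f := by omega
    exact_mod_cast this
  have hpt : ∀ x ∈ negSet f, (n : ℝ) - 2 * (diffSet z x).card ≤
      2 * ((m - (diffSet z x).card : ℕ) : ℝ) + (f2Degree f - m) := by
    intro x _
    have hsub : (m : ℝ) ≤ ((m - (diffSet z x).card : ℕ) : ℝ) + (diffSet z x).card := by
      have : m ≤ (m - (diffSet z x).card) + (diffSet z x).card := by omega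
      exact_mod_cast this
    linarith
  refine (Finset.sum_le_sum hpt).trans ?_
  rw [Finset.sum_add_distrib, ← Finset.mul_sum, Finset.sum_const, nsmul_eq_mul]
  linarith

theorem sum_signv_eq_zero {n : ℕ} (i : Fin n) : ∑ x : Fin n → Bool, signv (x i) = 0 := by
  refine Finset.sum_ninvolution (fun x => Function.update x i (!x i)) ?_ ?_ ?_ ?_
  · intro x
    cases x i <;> simp [signv]
  · intro x _ h
    simpa using congrFun h i
  · simp
  · intro x
    simp

theorem fourierCoeff_singleton {n : ℕ} {f : (Fin n → Bool) → ℝ} (hf : IsBooleanFunc f)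
    (i : Fin n) :
    fourierCoeff f {i} = -2 * (∑ x ∈ negSet f, signv (x i)) / 2 ^ n := by
  have h : ∀ x, f x * signv (x i) = signv (x i) - 2 * (if f x = -1 then signv (x i) else 0) := by
    intro x
    rcases hf x with hx | hx
    · rw [if_neg (by rw [hx]; norm_num), hx]; ring
    · rw [if_pos hx, hx]; ring
  simp only [fourierCoeff, Finset.prod_singleton, h]
  rw [Finset.sum_sub_distrib, sum_signv_eq_zero, ← Finset.mul_sum, negSet, Finset.sum_filter]
  ring

theorem sum_signv_mul_signv {n : ℕ} (z x : Fin n → Bool) :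
    ∑ i, signv (z i) * signv (x i) = n - 2 * (diffSet z x).card := by
  have h : ∀ i, signv (z i) * signv (x i) = 1 - 2 * (if x i ≠ z i then 1 else 0) := by
    intro i
    cases z i <;> cases x i <;> norm_num [signv]
  simp only [h, Finset.sum_sub_distrib, ← Finset.mul_sum, diffSet, Finset.card_filter]
  simp

/-- **Lemma (level-1 bound).** There is a universal constant `C > 0` such that every
Boolean function `f` satisfies `∑ᵢ |f̂({i})| ≤ C · δ(f) · deg₂(f)`. -/
theorem level_one_bound :
    ∃ C : ℝ, 0 < C ∧
      ∀ (n : ℕ), 0 < n → ∀ f : (Fin n → Bool) → ℝ, IsBooleanFunc f →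
        (∑ i : Fin n, |fourierCoeff f {i}|) ≤ C * weight f * (f2Degree f : ℝ) := by
  refine ⟨2, two_pos, fun n _ f hf => ?_⟩
  let z : Fin n → Bool := fun i => decide (∑ x ∈ negSet f, signv (x i) < 0)
  have habs : ∀ i, |fourierCoeff f {i}| =
      2 / 2 ^ n * ∑ x ∈ negSet f, signv (z i) * signv (x i) := by
    intro i
    rw [fourierCoeff_singleton hf, abs_div, abs_mul, ← Finset.mul_sum,
      abs_of_pos (by positivity : (0 : ℝ) < 2 ^ n)]
    have hz : |∑ x ∈ negSet f, signv (x i)| = signv (z i) * ∑ x ∈ negSet f, signv (x i) := by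
      by_cases hneg : ∑ x ∈ negSet f, signv (x i) < 0
      · have hzi : z i = true := decide_eq_true hneg
        rw [abs_of_neg hneg, hzi, signv, if_pos rfl, neg_one_mul]
      · have hzi : z i = false := decide_eq_false hneg
        rw [abs_of_nonneg (not_lt.mp hneg), hzi, signv, if_neg Bool.false_ne_true, one_mul]
    rw [hz]
    norm_num
    ring
  simp only [habs]
  rw [← Finset.mul_sum, Finset.sum_comm]
  simp only [sum_signv_mul_signv]
  calc 2 / 2 ^ n * ∑ x ∈ negSet f, ((n : ℝ) - 2 * (diffSet z x).card)
      ≤ 2 / 2 ^ n * ((negSet f).card * f2Degree f) :=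
        mul_le_mul_of_nonneg_left (sum_sub_two_mul_diffSet_card_le f z) (by positivity)
    _ = 2 * weight f * f2Degree f := by
        rw [weight, negSet]
        ring

end BoolFunc

end
end

section
/- For every positive integer n and every Boolean function f : {-1,1}^n → {-1,1} with k(f) ≥ 2, the weight satisfies δ(f) ≥ (k(f) − 1)/(4·k'(f)^2); in particular δ(f) ≥ k(f)/(8·k'(f)^2). -/
open scoped BigOperators
open scoped Classical

noncomputable section

namespace BoolFunc

lemma sum_prod_signv_mul {n : ℕ} (x y : Fin n → Bool) :
    ∑ S : Finset (Fin n), (∏ i ∈ S, signv (x i)) * ∏ i ∈ S, signv (y i) =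
      if x = y then 2 ^ n else 0 := by
  simp_rw [← Finset.prod_mul_distrib]
  rw [← Finset.powerset_univ, ← Finset.prod_one_add]
  split_ifs with h
  · subst h
    have h2 : ∀ i, 1 + signv (x i) * signv (x i) = 2 := fun i => by
      cases x i <;> norm_num [signv]
    simp [h2]
  · obtain ⟨i, hi⟩ := Function.ne_iff.mp h
    refine Finset.prod_eq_zero (Finset.mem_univ i) ?_
    cases hx : x i <;> cases hy : y i <;> simp_all [signv]

/-- **Parseval's identity** on the hypercube. -/
lemma sum_fourierCoeff_sq {n : ℕ} (f : (Fin n → Bool) → ℝ) :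
    ∑ S, fourierCoeff f S ^ 2 = (∑ x, f x ^ 2) / 2 ^ n := by
  have key : ∑ S : Finset (Fin n), (∑ x, f x * ∏ i ∈ S, signv (x i)) ^ 2 =
      (∑ x, f x ^ 2) * 2 ^ n := by
    calc ∑ S : Finset (Fin n), (∑ x, f x * ∏ i ∈ S, signv (x i)) ^ 2
        = ∑ x, ∑ y, f x * f y *
            ∑ S : Finset (Fin n), (∏ i ∈ S, signv (x i)) * ∏ i ∈ S, signv (y i) := by
          simp_rw [sq, Finset.sum_mul_sum, Finset.mul_sum]
          rw [Finset.sum_comm]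
          refine Finset.sum_congr rfl fun x _ => ?_
          rw [Finset.sum_comm]
          exact Finset.sum_congr rfl fun y _ => Finset.sum_congr rfl fun S _ => by ring
      _ = (∑ x, f x ^ 2) * 2 ^ n := by
          simp [sum_prod_signv_mul, Finset.sum_mul, sq]
  simp only [fourierCoeff, div_pow]
  rw [← Finset.sum_div, key]
  field_simp

lemma IsBooleanFunc.sum_fourierCoeff_sq_eq_one {n : ℕ} {f : (Fin n → Bool) → ℝ}
    (hf : IsBooleanFunc f) : ∑ S, fourierCoeff f S ^ 2 = 1 := by
  have h : ∀ x, f x ^ 2 = 1 := fun x => by rcases hf x with h | h <;> simp [h]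
  simp [sum_fourierCoeff_sq, h]

lemma IsBooleanFunc.fourierCoeff_empty {n : ℕ} {f : (Fin n → Bool) → ℝ}
    (hf : IsBooleanFunc f) : fourierCoeff f ∅ = 1 - 2 * weight f := by
  have h : ∀ x, f x = 1 - 2 * if f x = -1 then 1 else 0 := fun x => by
    rcases hf x with h | h <;> norm_num [h]
  have hs : ∑ x, f x =
      2 ^ n - 2 * ((Finset.univ.filter fun x : Fin n → Bool => f x = -1).card : ℝ) := by
    rw [Finset.sum_congr rfl fun x _ => h x, Finset.sum_sub_distrib, ← Finset.mul_sum]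
    simp
  simp only [fourierCoeff, weight, Finset.prod_empty, mul_one, hs]
  field_simp

lemma one_div_abs_fourierCoeff_le_maxSuppEntropy {n : ℕ} {f : (Fin n → Bool) → ℝ}
    {S : Finset (Fin n)} (hS : S ∈ fourierSupport f) :
    1 / |fourierCoeff f S| ≤ maxSuppEntropy f :=
  le_csSup ((Finset.finite_toSet _).image _).bddAbove ⟨S, hS, rfl⟩

lemma one_le_maxSuppEntropy_sq_mul {n : ℕ} {f : (Fin n → Bool) → ℝ}
    {S : Finset (Fin n)} (hS : S ∈ fourierSupport f) :
    1 ≤ maxSuppEntropy f ^ 2 * fourierCoeff f S ^ 2 := by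
  have hpos : 0 < |fourierCoeff f S| := abs_pos.mpr (Finset.mem_filter.mp hS).2
  have h := (div_le_iff₀ hpos).mp (one_div_abs_fourierCoeff_le_maxSuppEntropy hS)
  rw [← sq_abs (fourierCoeff f S), ← mul_pow]
  exact one_le_pow₀ h

lemma IsBooleanFunc.sum_erase_empty_fourierCoeff_sq {n : ℕ} {f : (Fin n → Bool) → ℝ}
    (hf : IsBooleanFunc f) :
    ∑ S ∈ Finset.univ.erase ∅, fourierCoeff f S ^ 2 = 4 * weight f * (1 - weight f) := by
  have h := Finset.add_sum_erase Finset.univ (fun S => fourierCoeff f S ^ 2)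
    (Finset.mem_univ (∅ : Finset (Fin n)))
  simp only [hf.sum_fourierCoeff_sq_eq_one, hf.fourierCoeff_empty] at h
  linarith

lemma IsBooleanFunc.sparsity_sub_one_le {n : ℕ} {f : (Fin n → Bool) → ℝ}
    (hf : IsBooleanFunc f) :
    (sparsity f : ℝ) - 1 ≤ 4 * maxSuppEntropy f ^ 2 * weight f := by
  have hcard : (sparsity f : ℝ) - 1 ≤ ((fourierSupport f).erase ∅).card := by
    have : sparsity f ≤ ((fourierSupport f).erase ∅).card + 1 := by
      have := Finset.pred_card_le_card_erase (s := fourierSupport f) (a := ∅)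
      unfold sparsity
      omega
    have : (sparsity f : ℝ) ≤ ((fourierSupport f).erase ∅).card + 1 := by exact_mod_cast this
    linarith
  calc (sparsity f : ℝ) - 1
      ≤ ∑ S ∈ (fourierSupport f).erase ∅, (1 : ℝ) := by simpa using hcard
    _ ≤ ∑ S ∈ (fourierSupport f).erase ∅, maxSuppEntropy f ^ 2 * fourierCoeff f S ^ 2 :=
        Finset.sum_le_sum fun S hS => one_le_maxSuppEntropy_sq_mul (Finset.mem_of_mem_erase hS)
    _ ≤ ∑ S ∈ Finset.univ.erase ∅, maxSuppEntropy f ^ 2 * fourierCoeff f S ^ 2 :=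
        Finset.sum_le_sum_of_subset_of_nonneg
          (Finset.erase_subset_erase _ (Finset.subset_univ _)) fun S _ _ => by positivity
    _ = maxSuppEntropy f ^ 2 * (4 * weight f * (1 - weight f)) := by
        rw [← Finset.mul_sum, hf.sum_erase_empty_fourierCoeff_sq]
    _ ≤ 4 * maxSuppEntropy f ^ 2 * weight f := by
        nlinarith [sq_nonneg (maxSuppEntropy f * weight f)]

/-- **Claim.** For every Boolean function `f` with `k(f) ≥ 2`,
`δ(f) ≥ (k(f) - 1)/(4 k'(f)²)`; in particular `δ(f) ≥ k(f)/(8 k'(f)²)`. -/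
theorem delta_ge_sparsity_div_maxSuppEntropy_sq
    (n : ℕ) (hn : 0 < n) (f : (Fin n → Bool) → ℝ) (hf : IsBooleanFunc f)
    (hk : 2 ≤ sparsity f) :
    ((sparsity f : ℝ) - 1) / (4 * (maxSuppEntropy f) ^ 2) ≤ weight f ∧
    (sparsity f : ℝ) / (8 * (maxSuppEntropy f) ^ 2) ≤ weight f := by
  have hsub := hf.sparsity_sub_one_le
  have hk' : (2 : ℝ) ≤ sparsity f := by exact_mod_cast hk
  have hpos : 0 < maxSuppEntropy f ^ 2 := by
    rw [sq_pos_iff]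
    intro h0
    simp only [h0] at hsub
    linarith
  constructor <;> rw [div_le_iff₀ (by positivity)] <;> linarith

end BoolFunc

end
end
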